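/- (No positive exact frame representation of quantum theory.) Let d ≥ 2. There do not exist a finite type ι and families F, D : ι → Matrix (Fin d) (Fin d) ℂ such that: every F_i is positive semidefinite with tr(F_i) = 1; the family F spans the real vector space of self-adjoint d×d complex matrices; every D_i is positive semidefinite; Σ_{i ∈ ι} D_i = 1 (the identity matrix); and tr(D_i · F_j) = δ_{ij} for all i, j ∈ ι. -/

import Mathlib

open scoped ComplexOrder

open scoped MatrixOrder in
/-- Two positive semidefinite matrices whose product has trace zero are orthogonal. -/
lemma mul_eq_zero_of_trace_mul_eq_zero {n : Type*} [Fintype n] {A B : Matrix n n ℂ}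
    (hA : A.PosSemidef) (hB : B.PosSemidef) (h : (A * B).trace = 0) : A * B = 0 := by
  classical
  obtain ⟨P, rfl⟩ := CStarAlgebra.nonneg_iff_eq_star_mul_self.mp hA.nonneg
  obtain ⟨Q, rfl⟩ := CStarAlgebra.nonneg_iff_eq_star_mul_self.mp hB.nonneg
  simp only [Matrix.star_eq_conjTranspose] at h ⊢
  have hPQ : P * Q.conjTranspose = 0 := by
    rw [← Matrix.trace_mul_conjTranspose_self_eq_zero_iff, ← h, Matrix.conjTranspose_mul,
      Matrix.conjTranspose_conjTranspose, Matrix.mul_assoc P.conjTranspose,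
      Matrix.trace_mul_comm P.conjTranspose]
    simp only [Matrix.mul_assoc]
  rw [Matrix.mul_assoc, ← Matrix.mul_assoc P, hPQ, Matrix.zero_mul, Matrix.mul_zero]

/-- Elements of the span of a pairwise commuting family commute. -/
lemma commute_of_mem_span_range {ι R A : Type*} [CommSemiring R] [Semiring A] [Algebra R A]
    {f : ι → A} (hf : ∀ i j, Commute (f i) (f j)) {a b : A}
    (ha : a ∈ Submodule.span R (Set.range f)) (hb : b ∈ Submodule.span R (Set.range f)) :
    Commute a b := by
  induction ha, hb using Submodule.span_induction₂ with
  | mem_mem x y hx hy =>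
    obtain ⟨i, rfl⟩ := hx
    obtain ⟨j, rfl⟩ := hy
    exact hf i j
  | zero_left y hy => exact Commute.zero_left y
  | zero_right x hx => exact Commute.zero_right x
  | add_left x y z hx hy hz h₁ h₂ => exact h₁.add_left h₂
  | add_right x y z hx hy hz h₁ h₂ => exact h₁.add_right h₂
  | smul_left r x y hx hy h => exact h.smul_left r
  | smul_right r x y hx hy h => exact h.smul_right r

/-- In dimension at least two there are noncommuting self-adjoint matrices. -/
lemma exists_selfAdjoint_not_commute {d : ℕ} (hd : 2 ≤ d) :
    ∃ A B : Matrix (Fin d) (Fin d) ℂ, IsSelfAdjoint A ∧ IsSelfAdjoint B ∧ ¬ Commute A B := by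
  let p : Fin d := ⟨0, by omega⟩
  let q : Fin d := ⟨1, by omega⟩
  have hpq : p ≠ q := by simp [p, q]
  refine ⟨Matrix.single p p 1, Matrix.single p q 1 + Matrix.single q p 1, ?_, ?_, fun h => ?_⟩
  · simp [isSelfAdjoint_iff, Matrix.star_eq_conjTranspose]
  · simp [isSelfAdjoint_iff, Matrix.star_eq_conjTranspose, add_comm]
  · have := congrFun (congrFun h.eq p) q
    simp [hpq, hpq.symm] at this

/-- No positive exact frame representation of quantum theory: for `d ≥ 2` there
is no finite family `F` of positive-semidefinite, trace-one `d × d` complex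
matrices spanning (over `ℝ`) the self-adjoint matrices, together with a dual
family `D` of positive-semidefinite matrices summing to the identity and
satisfying the biorthogonality relations `tr (D i * F j) = δ_{ij}`. -/
theorem no_positive_exact_frame_representation (d : ℕ) (hd : 2 ≤ d) :
    ¬ ∃ (m : ℕ) (F D : Fin m → Matrix (Fin d) (Fin d) ℂ),
      (∀ i, (F i).PosSemidef) ∧
      (∀ i, (F i).trace = 1) ∧
      Submodule.span ℝ (Set.range F) =
        selfAdjoint.submodule ℝ (Matrix (Fin d) (Fin d) ℂ) ∧
      (∀ i, (D i).PosSemidef) ∧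
      (∑ i, D i) = 1 ∧
      (∀ i j, (D i * F j).trace = if i = j then 1 else 0) := by
  rintro ⟨m, F, D, hF, -, hspan, hD, hsum, hdual⟩
  have hDF : ∀ i j, i ≠ j → D i * F j = 0 := fun i j hij =>
    mul_eq_zero_of_trace_mul_eq_zero (hD i) (hF j) (by simp [hdual, hij])
  have hFD : ∀ i, F i * D i = F i := fun i => by
    have h : D i * F i = F i := by
      rw [← Finset.sum_eq_single_of_mem (f := fun k => D k * F i) i (Finset.mem_univ i)
        (fun k _ hk => hDF k i hk), ← Finset.sum_mul, hsum, one_mul]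
    simpa [(hF i).isHermitian.eq, (hD i).isHermitian.eq] using congrArg Matrix.conjTranspose h
  have hFF : ∀ i j, i ≠ j → F i * F j = 0 := fun i j hij => by
    rw [← hFD i, mul_assoc, hDF i j hij, mul_zero]
  have hcomm : ∀ i j, Commute (F i) (F j) := fun i j => by
    rcases eq_or_ne i j with rfl | hij
    · exact Commute.refl _
    · rw [commute_iff_eq, hFF i j hij, hFF j i hij.symm]
  obtain ⟨A, B, hA, hB, hAB⟩ := exists_selfAdjoint_not_commute hd
  refine hAB ?_
  have hA' : A ∈ Submodule.span ℝ (Set.range F) := hspan ▸ hA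
  have hB' : B ∈ Submodule.span ℝ (Set.range F) := hspan ▸ hB
  exact commute_of_mem_span_range hcomm hA' hB'
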